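/- arXiv:2107.14307 — 3 statements merged into one kernel-verified Lean document; each statement's English description precedes it below -/
import Mathlib

section
/- Let ν > 0, k > 1/6, and set λ = min(ν, k − 1/6). Let û : ℝ × ℝ → ℝ (written û(t,x)) be twice continuously differentiable with ∂ₜû(t,x) = ν·∂ₓₓû(t,x) − û(t,x)·∂ₓû(t,x) for all t ≥ 0 and x ∈ [0,1], and boundary conditions ν·∂ₓû(t,0) = k·(û(t,0) + û(t,0)³) and ν·∂ₓû(t,1) = −k·(û(t,1) + û(t,1)³) for all t ≥ 0. Then the function E(t) = ∫₀¹ û(t,x)² dx satisfies the differential inequality E'(t) ≤ −λ·E(t) for all t ≥ 0. -/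
theorem hasDerivAt_slice_fst {w : ℝ × ℝ → ℝ} {t x : ℝ} (hw : DifferentiableAt ℝ w (t, x)) :
    HasDerivAt (fun s => w (s, x)) (fderiv ℝ w (t, x) (1, 0)) t :=
  hw.hasFDerivAt.comp_hasDerivAt t ((hasDerivAt_id t).prodMk (hasDerivAt_const t x))

theorem hasDerivAt_slice_snd {w : ℝ × ℝ → ℝ} {t x : ℝ} (hw : DifferentiableAt ℝ w (t, x)) :
    HasDerivAt (fun y => w (t, y)) (fderiv ℝ w (t, x) (0, 1)) x :=
  hw.hasFDerivAt.comp_hasDerivAt x ((hasDerivAt_const x t).prodMk (hasDerivAt_id x))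

/-- Differentiation under the integral sign for a jointly continuous derivative. -/
theorem hasDerivAt_intervalIntegral_of_continuous {F F' : ℝ → ℝ → ℝ} {a b : ℝ} (t : ℝ)
    (hF : ∀ s, Continuous (F s)) (hF' : Continuous (Function.uncurry F'))
    (hderiv : ∀ s x, HasDerivAt (fun r => F r x) (F' s x) s) :
    HasDerivAt (fun s => ∫ x in a..b, F s x) (∫ x in a..b, F' t x) t := by
  obtain ⟨C, hC⟩ := ((isCompact_closedBall t 1).prod
    (isCompact_uIcc (a := a) (b := b))).exists_bound_of_continuousOn hF'.continuousOn
  refine (intervalIntegral.hasDerivAt_integral_of_dominated_loc_of_deriv_le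
    (bound := fun _ => C) (Metric.closedBall_mem_nhds t one_pos)
    (Filter.Eventually.of_forall fun s => (hF s).aestronglyMeasurable)
    ((hF t).intervalIntegrable _ _)
    (hF'.comp (Continuous.prodMk_right t)).aestronglyMeasurable
    (Filter.Eventually.of_forall fun x hx s hs =>
      hC (s, x) ⟨hs, Set.uIoc_subset_uIcc hx⟩)
    intervalIntegrable_const
    (Filter.Eventually.of_forall fun x _ s _ => hderiv s x)).2

/-- The boundary terms of the energy identity are absorbed by the cubic feedback. -/
theorem boundary_terms_nonpos {k l : ℝ} (hk : 1 / 6 < k) (hl : l ≤ k - 1 / 6) (a b : ℝ) :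
    -2 * k * (a ^ 2 + a ^ 4) - 2 * k * (b ^ 2 + b ^ 4) - 2 / 3 * (a ^ 3 - b ^ 3)
      + 2 * l * (a ^ 2 + b ^ 2) ≤ 0 := by
  nlinarith [sq_nonneg (a + a ^ 2), sq_nonneg (b - b ^ 2),
    mul_nonneg (sub_nonneg.2 hl) (sq_nonneg a), mul_nonneg (sub_nonneg.2 hl) (sq_nonneg b),
    mul_nonneg (sub_nonneg.2 hk.le) (sq_nonneg (a ^ 2)),
    mul_nonneg (sub_nonneg.2 hk.le) (sq_nonneg (b ^ 2))]


/-- Partial derivative in the first (time) variable. -/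
noncomputable def pt (w : ℝ × ℝ → ℝ) (t x : ℝ) : ℝ := deriv (fun s => w (s, x)) t

/-- First partial derivative in the second (space) variable. -/
noncomputable def px (w : ℝ × ℝ → ℝ) (t x : ℝ) : ℝ := deriv (fun y => w (t, y)) x

/-- Second partial derivative in the second (space) variable. -/
noncomputable def pxx (w : ℝ × ℝ → ℝ) (t x : ℝ) : ℝ := deriv (fun y => px w t y) x

/-- differential inequality `E'(t) ≤ -λ·E(t)` for the energy of the
stabilized Burgers equation, with `λ = min ν (k - 1/6)`. -/
theorem stmt_4 (ν k : ℝ) (hν : 0 < ν) (hk : 1/6 < k) (u : ℝ × ℝ → ℝ)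
    (hu : ContDiff ℝ 2 u)
    (hpde : ∀ t ≥ (0:ℝ), ∀ x ∈ Set.Icc (0:ℝ) 1,
      pt u t x = ν * pxx u t x - u (t, x) * px u t x)
    (hbc0 : ∀ t ≥ (0:ℝ), ν * px u t 0 = k * (u (t, 0) + (u (t, 0)) ^ 3))
    (hbc1 : ∀ t ≥ (0:ℝ), ν * px u t 1 = -k * (u (t, 1) + (u (t, 1)) ^ 3)) :
    ∀ t ≥ (0:ℝ), ∃ d : ℝ,
      HasDerivAt (fun s => ∫ x in (0:ℝ)..1, (u (s, x)) ^ 2) d t ∧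
      d ≤ -(min ν (k - 1/6)) * ∫ x in (0:ℝ)..1, (u (t, x)) ^ 2 := by
  intro t ht
  set l := min ν (k - 1 / 6) with hl_def
  have hl : 0 < l := lt_min hν (by linarith)
  have hlν : l ≤ ν := min_le_left _ _
  have hlk : l ≤ k - 1 / 6 := min_le_right _ _
  have hdiff : Differentiable ℝ u := hu.differentiable (by norm_num)
  have hfderiv : ContDiff ℝ 1 (fderiv ℝ u) := hu.fderiv_right (by norm_num)
  have hpt : ∀ s x, HasDerivAt (fun r => u (r, x)) (pt u s x) s := fun s x =>
    (hasDerivAt_slice_fst (hdiff _)).differentiableAt.hasDerivAt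
  have hpx : ∀ s x, HasDerivAt (fun y => u (s, y)) (px u s x) x := fun s x =>
    (hasDerivAt_slice_snd (hdiff _)).differentiableAt.hasDerivAt
  have hpt_eq : Function.uncurry (pt u) = fun p => fderiv ℝ u p (1, 0) := by
    ext ⟨s, x⟩
    exact (hasDerivAt_slice_fst (hdiff _)).deriv
  have hpx_eq : Function.uncurry (px u) = fun p => fderiv ℝ u p (0, 1) := by
    ext ⟨s, x⟩
    exact (hasDerivAt_slice_snd (hdiff _)).deriv
  have hpt_cont : Continuous (Function.uncurry (pt u)) := by
    rw [hpt_eq]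
    exact hfderiv.continuous.clm_apply continuous_const
  have hpx_contDiff : ContDiff ℝ 1 (Function.uncurry (px u)) := by
    rw [hpx_eq]
    exact hfderiv.clm_apply contDiff_const
  have hpx_diff : Differentiable ℝ (Function.uncurry (px u)) :=
    hpx_contDiff.differentiable (by norm_num)
  have hpxx : ∀ x, HasDerivAt (fun y => px u t y) (pxx u t x) x := fun x =>
    (hasDerivAt_slice_snd (hpx_diff (t, x))).differentiableAt.hasDerivAt
  have hpxx_cont : Continuous (fun x => pxx u t x) := by
    have h : (fun x => pxx u t x) =
        fun x => fderiv ℝ (Function.uncurry (px u)) (t, x) (0, 1) := by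
      ext x
      exact (hasDerivAt_slice_snd (hpx_diff (t, x))).deriv
    rw [h]
    exact ((hpx_contDiff.continuous_fderiv (by norm_num)).comp
      (Continuous.prodMk_right t)).clm_apply continuous_const
  have hu_slice : ∀ s, Continuous fun x => u (s, x) := fun s =>
    hu.continuous.comp (Continuous.prodMk_right s)
  have hut_cont := hu_slice t
  have hpx_cont : Continuous fun x => px u t x :=
    hpx_contDiff.continuous.comp (Continuous.prodMk_right t)
  have hptt_cont : Continuous fun x => pt u t x :=
    hpt_cont.comp (Continuous.prodMk_right t)
  refine ⟨∫ x in (0:ℝ)..1, 2 * u (t, x) * pt u t x,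
    hasDerivAt_intervalIntegral_of_continuous
      (F := fun s x => u (s, x) ^ 2) (F' := fun s x => 2 * u (s, x) * pt u s x) t
      (fun s => (hu_slice s).pow 2)
      ((continuous_const.mul hu.continuous).mul hpt_cont)
      (fun s x => by simpa using (hpt s x).fun_pow 2), ?_⟩
  let G : ℝ → ℝ := fun x =>
    2 * ν * (u (t, x) * px u t x) - 2 / 3 * u (t, x) ^ 3 + 4 * l * ((x - 1 / 2) * u (t, x) ^ 2)
  let G' : ℝ → ℝ := fun x =>
    2 * ν * (px u t x * px u t x + u (t, x) * pxx u t x)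
      - 2 / 3 * (3 * u (t, x) ^ 2 * px u t x)
      + 4 * l * (1 * u (t, x) ^ 2 + (x - 1 / 2) * (2 * u (t, x) * px u t x))
  have hG : ∀ x, HasDerivAt G (G' x) x := fun x => by
    have h2 : HasDerivAt (fun y => u (t, y) ^ 2) (2 * u (t, x) * px u t x) x := by
      simpa using (hpx t x).fun_pow 2
    have h3 : HasDerivAt (fun y => u (t, y) ^ 3) (3 * u (t, x) ^ 2 * px u t x) x := by
      simpa using (hpx t x).fun_pow 3
    exact ((((hpx t x).mul (hpxx x)).const_mul (2 * ν)).sub (h3.const_mul (2 / 3))).add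
      ((((hasDerivAt_id x).sub_const (1 / 2)).mul h2).const_mul (4 * l))
  have hG'_cont : Continuous G' := by fun_prop
  have hFTC : ∫ x in (0:ℝ)..1, G' x = G 1 - G 0 :=
    intervalIntegral.integral_eq_sub_of_hasDerivAt (fun x _ => hG x)
      (hG'_cont.intervalIntegrable _ _)
  have hsq_cont : Continuous fun x => 2 * l * u (t, x) ^ 2 := by fun_prop
  have hmono : ∫ x in (0:ℝ)..1, 2 * u (t, x) * pt u t x ≤
      ∫ x in (0:ℝ)..1, (G' x - 2 * l * u (t, x) ^ 2) := by
    refine intervalIntegral.integral_mono_on zero_le_one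
      (Continuous.intervalIntegrable (by fun_prop) _ _)
      ((hG'_cont.sub hsq_cont).intervalIntegrable _ _) fun x hx => ?_
    rw [hpde t ht x hx]
    have hpoincare : 0 ≤ px u t x ^ 2 + u (t, x) ^ 2
        + 4 * (x - 1 / 2) * (u (t, x) * px u t x) := by
      nlinarith [mul_nonneg hx.1 (sq_nonneg (u (t, x) + px u t x)),
        mul_nonneg (sub_nonneg.2 hx.2) (sq_nonneg (u (t, x) - px u t x))]
    have h1 := mul_nonneg hl.le hpoincare
    have h2 := mul_nonneg (sub_nonneg.2 hlν) (sq_nonneg (px u t x))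
    simp only [G']
    nlinarith
  rw [intervalIntegral.integral_sub (hG'_cont.intervalIntegrable _ _)
    (hsq_cont.intervalIntegrable _ _), hFTC, intervalIntegral.integral_const_mul] at hmono
  have hboundary : G 1 - G 0 ≤ 0 := by
    have h : G 1 - G 0 = 2 * u (t, 1) * (ν * px u t 1) - 2 * u (t, 0) * (ν * px u t 0)
        - 2 / 3 * (u (t, 1) ^ 3 - u (t, 0) ^ 3) + 2 * l * (u (t, 1) ^ 2 + u (t, 0) ^ 2) := by
      simp only [G]
      ring
    rw [h, hbc0 t ht, hbc1 t ht]
    linarith [boundary_terms_nonpos hk hlk (u (t, 1)) (u (t, 0))]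
  have hE : 0 ≤ ∫ x in (0:ℝ)..1, u (t, x) ^ 2 :=
    intervalIntegral.integral_nonneg zero_le_one fun x _ => sq_nonneg _
  linarith [mul_nonneg hl.le hE]
end

section
/- Let ν > 0, k > 1/6, and set λ = min(ν, k − 1/6). Let û : ℝ × ℝ → ℝ (written û(t,x)) be twice continuously differentiable with ∂ₜû(t,x) = ν·∂ₓₓû(t,x) − û(t,x)·∂ₓû(t,x) for all t ≥ 0 and x ∈ [0,1], and boundary conditions ν·∂ₓû(t,0) = k·(û(t,0) + û(t,0)³) and ν·∂ₓû(t,1) = −k·(û(t,1) + û(t,1)³) for all t ≥ 0. Then for every t ≥ 0, (∫₀¹ û(t,x)² dx)^{1/2} ≤ (∫₀¹ û(0,x)² dx)^{1/2} · e^{−λt/2}. -/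
open MeasureTheory Set Topology

/-- Differentiation under the integral sign for the energy of a `C¹` function on the plane. -/
theorem hasDerivAt_integral_sq {u v : ℝ × ℝ → ℝ} {a b : ℝ} (hu : Continuous u)
    (hv : Continuous v) (huv : ∀ s x, HasDerivAt (fun r => u (r, x)) (v (s, x)) s) (t : ℝ) :
    HasDerivAt (fun s => ∫ x in a..b, u (s, x) ^ 2) (∫ x in a..b, 2 * u (t, x) * v (t, x)) t := by
  have hw : Continuous fun p : ℝ × ℝ => 2 * u p * v p := by fun_prop
  obtain ⟨C, hC⟩ := (((isCompact_Icc (a := t - 1) (b := t + 1)).prod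
    (isCompact_uIcc (a := a) (b := b))).exists_bound_of_continuousOn hw.continuousOn)
  refine (intervalIntegral.hasDerivAt_integral_of_dominated_loc_of_deriv_le
    (μ := volume) (F := fun s x => u (s, x) ^ 2) (F' := fun s x => 2 * u (s, x) * v (s, x))
    (bound := fun _ => C) (Icc_mem_nhds (by linarith : t - 1 < t) (by linarith : t < t + 1))
    ?_ ?_ ?_ ?_ ?_ ?_).2
  · exact .of_forall fun s => Continuous.aestronglyMeasurable (by fun_prop)
  · exact Continuous.intervalIntegrable (by fun_prop) _ _
  · exact Continuous.aestronglyMeasurable (by fun_prop)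
  · exact .of_forall fun x hx s hs => hC (s, x) ⟨hs, uIoc_subset_uIcc hx⟩
  · exact intervalIntegrable_const
  · refine .of_forall fun x _ s _ => ?_
    simpa using (huv s x).fun_pow 2

/-- The energy dissipation inequality for a time slice of the Burgers equation under the cubic
boundary feedback. -/
theorem integral_burgers_dissipation_nonpos {ν k l : ℝ} (hl : 0 ≤ l) (hlν : l ≤ ν)
    (hlk : l ≤ k - 1 / 6) {f g h : ℝ → ℝ} (hf : ∀ x, HasDerivAt f (g x) x)
    (hg : ∀ x, HasDerivAt g (h x) x) (hh : Continuous h)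
    (h0 : ν * g 0 = k * (f 0 + f 0 ^ 3)) (h1 : ν * g 1 = -k * (f 1 + f 1 ^ 3)) :
    ∫ x in (0 : ℝ)..1, (2 * f x * (ν * h x - f x * g x) + l * f x ^ 2) ≤ 0 := by
  have hfc : Continuous f := continuous_iff_continuousAt.2 fun x => (hf x).continuousAt
  have hgc : Continuous g := continuous_iff_continuousAt.2 fun x => (hg x).continuousAt
  have hF : ∀ x, HasDerivAt
      (fun y => 2 * ν * (f y * g y) - 2 / 3 * f y ^ 3 + 2 * l * ((y - 1 / 2) * f y ^ 2))
      (2 * ν * (g x * g x + f x * h x) - 2 / 3 * (3 * f x ^ 2 * g x)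
        + 2 * l * (f x ^ 2 + (x - 1 / 2) * (2 * f x * g x))) x := by
    intro x
    have h3 := (hf x).pow 3
    have h2 := (hf x).pow 2
    have hq := ((hasDerivAt_id x).sub_const (1 / 2)).mul h2
    refine (((((hf x).mul (hg x)).const_mul (2 * ν)).sub (h3.const_mul (2 / 3))).add
      (hq.const_mul (2 * l))).congr_deriv ?_
    norm_num
  have hint := intervalIntegral.integral_eq_sub_of_hasDerivAt (a := 0) (b := 1)
    (fun x _ => hF x) (Continuous.intervalIntegrable (by fun_prop) _ _)
  refine (intervalIntegral.integral_mono_on zero_le_one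
    (Continuous.intervalIntegrable (by fun_prop) _ _)
    (Continuous.intervalIntegrable (by fun_prop) _ _) fun x hx => ?_).trans
    (hint.trans_le ?_)
  · have hcross : 0 ≤ f x ^ 2 + g x ^ 2 + 4 * (x - 1 / 2) * (f x * g x) := by
      nlinarith [mul_nonneg hx.1 (sq_nonneg (f x + g x)),
        mul_nonneg (sub_nonneg.2 hx.2) (sq_nonneg (f x - g x))]
    nlinarith [mul_nonneg hl hcross, mul_nonneg (sub_nonneg.2 hlν) (sq_nonneg (g x))]
  · have hb (a : ℝ) : l * (a ^ 2 + a ^ 4) ≤ (k - 1 / 6) * (a ^ 2 + a ^ 4) :=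
      mul_le_mul_of_nonneg_right hlk (by positivity)
    have e0 : ν * (f 0 * g 0) = k * (f 0 ^ 2 + f 0 ^ 4) := by linear_combination f 0 * h0
    have e1 : ν * (f 1 * g 1) = -k * (f 1 ^ 2 + f 1 ^ 4) := by linear_combination f 1 * h1
    have p (a : ℝ) : 0 ≤ l * (a ^ 2 + a ^ 4) := by positivity
    have q (a : ℝ) : 0 ≤ l * a ^ 4 := by positivity
    nlinarith [hb (f 0), hb (f 1), p (f 0), p (f 1), q (f 0), q (f 1),
      sq_nonneg (f 0 ^ 2 - f 0), sq_nonneg (f 1 ^ 2 + f 1)]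

/-- A function with `E' + l E ≤ 0` on `[0, ∞)` decays exponentially there. -/
theorem le_mul_exp_neg_of_deriv_add_le {E E' : ℝ → ℝ} {l : ℝ}
    (hE : ∀ t, HasDerivAt E (E' t) t) (h : ∀ t ≥ 0, E' t + l * E t ≤ 0) {t : ℝ} (ht : 0 ≤ t) :
    E t ≤ E 0 * Real.exp (-l * t) := by
  have hd (s : ℝ) : HasDerivAt (fun r => E r * Real.exp (l * r))
      ((E' s + l * E s) * Real.exp (l * s)) s := by
    refine ((hE s).mul ((hasDerivAt_id s).const_mul l).exp).congr_deriv ?_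
    simp only [id]
    ring
  have hanti : AntitoneOn (fun r => E r * Real.exp (l * r)) (Ici 0) := by
    refine antitoneOn_of_deriv_nonpos (convex_Ici 0)
      (fun s _ => (hd s).continuousAt.continuousWithinAt)
      (fun s _ => (hd s).differentiableAt.differentiableWithinAt) fun s hs => ?_
    rw [interior_Ici] at hs
    rw [(hd s).deriv]
    exact mul_nonpos_of_nonpos_of_nonneg (h s (le_of_lt hs)) (Real.exp_pos _).le
  have key := hanti (mem_Ici.2 le_rfl) (mem_Ici.2 ht) ht
  simp only [mul_zero, Real.exp_zero, mul_one] at key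
  rw [neg_mul, Real.exp_neg, ← div_eq_mul_inv, le_div_iff₀ (Real.exp_pos _)]
  exact key


/-- exponential L²(0,1) decay estimate for the stabilized Burgers
equation of Theorem 1, with `λ = min ν (k - 1/6)`. -/
theorem stmt_5 (ν k : ℝ) (hν : 0 < ν) (hk : 1/6 < k) (u : ℝ × ℝ → ℝ)
    (hu : ContDiff ℝ 2 u)
    (hpde : ∀ t ≥ (0:ℝ), ∀ x ∈ Set.Icc (0:ℝ) 1,
      pt u t x = ν * pxx u t x - u (t, x) * px u t x)
    (hbc0 : ∀ t ≥ (0:ℝ), ν * px u t 0 = k * (u (t, 0) + (u (t, 0)) ^ 3))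
    (hbc1 : ∀ t ≥ (0:ℝ), ν * px u t 1 = -k * (u (t, 1) + (u (t, 1)) ^ 3)) :
    ∀ t ≥ (0:ℝ),
      Real.sqrt (∫ x in (0:ℝ)..1, (u (t, x)) ^ 2) ≤
        Real.sqrt (∫ x in (0:ℝ)..1, (u (0, x)) ^ 2) *
          Real.exp (-(min ν (k - 1/6)) * t / 2) := by
  intro t ht
  set l := min ν (k - 1 / 6)
  have hl : 0 ≤ l := le_min hν.le (by linarith)
  have hdiff : Differentiable ℝ u := hu.differentiable (by norm_num)
  have hut (s x : ℝ) : HasDerivAt (fun r => u (r, x)) (pt u s x) s := by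
    have : DifferentiableAt ℝ (fun r => u (r, x)) s := by fun_prop
    exact this.hasDerivAt
  have hpt (s x : ℝ) : pt u s x = fderiv ℝ u (s, x) (1, 0) :=
    ((hdiff (s, x)).hasFDerivAt.comp_hasDerivAt s
      ((hasDerivAt_id s).prodMk (hasDerivAt_const s x))).deriv
  have hptc : Continuous fun p : ℝ × ℝ => pt u p.1 p.2 := by
    simp only [hpt]
    exact (hu.continuous_fderiv (by norm_num)).clm_apply continuous_const
  have hslice (s : ℝ) : ContDiff ℝ 2 fun x => u (s, x) := by fun_prop
  have hslice' (s : ℝ) : ContDiff ℝ 1 (px u s) :=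
    ((contDiff_succ_iff_deriv (n := 1)).1 (by simpa [one_add_one_eq_two] using hslice s)).2.2
  have hE := hasDerivAt_integral_sq (a := 0) (b := 1) hu.continuous hptc hut
  have hdec := le_mul_exp_neg_of_deriv_add_le (l := l) hE (fun s hs => ?_) ht
  · calc √(∫ x in (0 : ℝ)..1, u (t, x) ^ 2)
        ≤ √((∫ x in (0 : ℝ)..1, u (0, x) ^ 2) * Real.exp (-l * t)) := Real.sqrt_le_sqrt hdec
      _ = _ := by rw [Real.sqrt_mul' _ (Real.exp_pos _).le, Real.exp_half]
  · have hus : Continuous fun x => u (s, x) := (hslice s).continuous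
    have hpts : Continuous fun x => pt u s x := hptc.comp (Continuous.prodMk_right s)
    rw [← intervalIntegral.integral_const_mul, ← intervalIntegral.integral_add
      (Continuous.intervalIntegrable (by fun_prop) _ _)
      (Continuous.intervalIntegrable (by fun_prop) _ _)]
    refine le_of_eq_of_le (intervalIntegral.integral_congr fun x hx => ?_)
      (integral_burgers_dissipation_nonpos hl (min_le_left _ _) (min_le_right _ _)
        (fun x => ((hslice s).differentiable (by norm_num) x).hasDerivAt)
        (fun x => ((hslice' s).differentiable (by norm_num) x).hasDerivAt)
        ((hslice' s).continuous_deriv le_rfl) (hbc0 s hs) (hbc1 s hs))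
    rw [uIcc_of_le zero_le_one] at hx
    simp only [hpde s hs x hx]
    rfl
end

section
/- Let ν ∈ ℝ, let û, U : ℝ × ℝ → ℝ be twice continuously differentiable, let a, u_d : ℝ × ℝ → ℝ be continuous, and let r : ℝ → ℝ be continuously differentiable. Suppose that for all t ≥ 0 and x ∈ [0,1], U satisfies the regulator equation ∂ₜU = ν·∂ₓₓU − U·∂ₓU + a·(û + U) − (û·∂ₓU + U·∂ₓû) + u_d, together with the Neumann boundary conditions ν·∂ₓU(t,0) = F₀(t) and ν·∂ₓU(t,1) = F₁(t), where F₀(t) = û(t,0)·U(t,0) + (1/2)·U(t,0)² and F₁(t) = û(t,1)·U(t,1) + (1/2)·U(t,1)² + r'(t) − ∫₀¹ [a(t,x)·(û(t,x) + U(t,x)) + u_d(t,x)] dx. Then for every t ≥ 0, the map t ↦ ∫₀¹ U(t,x) dx is differentiable with derivative equal to r'(t). -/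
open MeasureTheory Set Topology

/-- Differentiation under the integral sign for a `C¹` integrand on the plane. -/
theorem hasDerivAt_intervalIntegral_of_contDiff {w : ℝ × ℝ → ℝ} (hw : ContDiff ℝ 1 w)
    (a b t : ℝ) :
    HasDerivAt (fun s => ∫ x in a..b, w (s, x)) (∫ x in a..b, pt w t x) t := by
  have hdiff : ∀ s x, HasDerivAt (fun s => w (s, x)) (fderiv ℝ w (s, x) (1, 0)) s := fun s x =>
    ((hw.differentiable one_ne_zero (s, x)).hasFDerivAt).comp_hasDerivAt s
      ((hasDerivAt_id s).prodMk (hasDerivAt_const s x))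
  have hpt : ∀ s x, pt w s x = fderiv ℝ w (s, x) (1, 0) := fun s x => (hdiff s x).deriv
  have hcont : Continuous fun p : ℝ × ℝ => pt w p.1 p.2 := by
    simp only [hpt]
    exact (hw.continuous_fderiv one_ne_zero).clm_apply continuous_const
  have hslice : ∀ s, Continuous fun x => w (s, x) := fun s =>
    hw.continuous.comp (by fun_prop)
  obtain ⟨C, hC⟩ := ((isCompact_Icc (a := t - 1) (b := t + 1)).prod
    (isCompact_uIcc (a := a) (b := b))).exists_bound_of_continuousOn hcont.continuousOn
  refine (intervalIntegral.hasDerivAt_integral_of_dominated_loc_of_deriv_le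
    (F := fun s x => w (s, x)) (F' := pt w) (bound := fun _ => C)
    (Icc_mem_nhds (by linarith : t - 1 < t) (by linarith : t < t + 1))
    (.of_forall fun s => (hslice s).aestronglyMeasurable)
    ((hslice t).intervalIntegrable a b)
    (Continuous.aestronglyMeasurable (hcont.comp (by fun_prop : Continuous fun x => (t, x))))
    (.of_forall fun x hx s hs => hC (s, x) ⟨hs, uIoc_subset_uIcc hx⟩)
    (intervalIntegrable_const) (.of_forall fun x _ s _ => ?_)).2
  rw [hpt]
  exact hdiff s x

theorem hasDerivAt_px {w : ℝ × ℝ → ℝ} (hw : ContDiff ℝ 2 w) (t x : ℝ) :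
    HasDerivAt (fun y => w (t, y)) (px w t x) x :=
  ((hw.comp (contDiff_prodMk_right t)).differentiable two_ne_zero x).hasDerivAt

theorem contDiff_px {w : ℝ × ℝ → ℝ} (hw : ContDiff ℝ 2 w) (t : ℝ) : ContDiff ℝ 1 (px w t) :=
  (contDiff_succ_iff_deriv (n := 1).1 (hw.comp (contDiff_prodMk_right t))).2.2

theorem hasDerivAt_pxx {w : ℝ × ℝ → ℝ} (hw : ContDiff ℝ 2 w) (t x : ℝ) :
    HasDerivAt (px w t) (pxx w t x) x :=
  ((contDiff_px hw t).differentiable one_ne_zero x).hasDerivAt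

theorem continuous_pxx {w : ℝ × ℝ → ℝ} (hw : ContDiff ℝ 2 w) (t : ℝ) : Continuous (pxx w t) :=
  (contDiff_px hw t).continuous_deriv le_rfl

/-- under the feedforward controllers F₀, F₁ of Theorem 1, the
spatial average of the regulator state `U` has derivative `r'(t)`. -/
theorem stmt_10 (ν : ℝ) (uh U a ud : ℝ × ℝ → ℝ) (r : ℝ → ℝ)
    (huh : ContDiff ℝ 2 uh) (hU : ContDiff ℝ 2 U)
    (ha : Continuous a) (hud : Continuous ud) (hr : ContDiff ℝ 1 r)
    (heq : ∀ t ≥ (0:ℝ), ∀ x ∈ Set.Icc (0:ℝ) 1,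
      pt U t x = ν * pxx U t x - U (t, x) * px U t x
        + a (t, x) * (uh (t, x) + U (t, x))
        - (uh (t, x) * px U t x + U (t, x) * px uh t x) + ud (t, x))
    (hbc0 : ∀ t ≥ (0:ℝ),
      ν * px U t 0 = uh (t, 0) * U (t, 0) + (1/2) * (U (t, 0)) ^ 2)
    (hbc1 : ∀ t ≥ (0:ℝ),
      ν * px U t 1 = uh (t, 1) * U (t, 1) + (1/2) * (U (t, 1)) ^ 2 + deriv r t
        - ∫ x in (0:ℝ)..1,
            (a (t, x) * (uh (t, x) + U (t, x)) + ud (t, x))) :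
    ∀ t ≥ (0:ℝ),
      HasDerivAt (fun s => ∫ x in (0:ℝ)..1, U (s, x)) (deriv r t) t := by
  intro t ht
  have hD := hasDerivAt_intervalIntegral_of_contDiff (hU.of_le one_le_two) 0 1 t
  suffices h : ∫ x in (0:ℝ)..1, pt U t x = deriv r t by rwa [h] at hD
  have hmk : Continuous fun x : ℝ => (t, x) := by fun_prop
  have cU : Continuous fun x => U (t, x) := hU.continuous.comp hmk
  have cuh : Continuous fun x => uh (t, x) := huh.continuous.comp hmk
  have ca : Continuous fun x => a (t, x) := ha.comp hmk
  have cud : Continuous fun x => ud (t, x) := hud.comp hmk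
  have cpU : Continuous (px U t) := (contDiff_px hU t).continuous
  have cpuh : Continuous (px uh t) := (contDiff_px huh t).continuous
  have cpxx : Continuous (pxx U t) := continuous_pxx hU t
  set flux' : ℝ → ℝ := fun x => ν * pxx U t x - U (t, x) * px U t x
    - (uh (t, x) * px U t x + U (t, x) * px uh t x) with hflux'
  set source : ℝ → ℝ := fun x => a (t, x) * (uh (t, x) + U (t, x)) + ud (t, x) with hsource
  have cflux' : Continuous flux' := by fun_prop
  have csource : Continuous source := by fun_prop
  have hsplit : ∫ x in (0:ℝ)..1, pt U t x = ∫ x in (0:ℝ)..1, (flux' x + source x) := by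
    refine intervalIntegral.integral_congr fun x hx => ?_
    rw [uIcc_of_le zero_le_one] at hx
    simp only [heq t ht x hx, hflux', hsource]
    ring
  have hflux : ∀ x, HasDerivAt
      (fun y => ν * px U t y - (1/2) * U (t, y) ^ 2 - uh (t, y) * U (t, y)) (flux' x) x := by
    intro x
    have dU := hasDerivAt_px hU t x
    refine ((((hasDerivAt_pxx hU t x).const_mul ν).sub ((dU.pow 2).const_mul (1/2))).sub
      ((hasDerivAt_px huh t x).mul dU)).congr_deriv ?_
    simp only [hflux']
    ring
  rw [hsplit, intervalIntegral.integral_add (cflux'.intervalIntegrable 0 1)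
    (csource.intervalIntegrable 0 1), intervalIntegral.integral_eq_sub_of_hasDerivAt
    (fun x _ => hflux x) (cflux'.intervalIntegrable 0 1), hbc0 t ht, hbc1 t ht]
  ring
end
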